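/- Let I be a nonempty subset of {1,…,n}. For every real 0 ≤ λ ≤ 1, P( C_I(σ) ≤ λ·H(I) ) ≤ 2·e^{1 − Q(λ)·H(I)}, where Q(λ) = λ log λ − λ + 1 (with Q(0) = 1). -/

import Mathlib

open Finset

/-- The number of cycles of length `j` in the permutation `σ` of `{1,…,n}`
(fixed points count as cycles of length 1): the number of points whose
orbit under `σ` has size `j`, divided by `j`. -/
noncomputable def cycleCount {n : ℕ} (σ : Equiv.Perm (Fin n)) (j : ℕ) : ℕ :=
  (Finset.univ.filter fun x => Function.minimalPeriod (⇑σ) x = j).card / j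

/-- The number of cycles of `σ` whose length lies in the set `I`. -/
noncomputable def cycleCountIn {n : ℕ} (σ : Equiv.Perm (Fin n)) (I : Finset ℕ) : ℕ :=
  ∑ j ∈ I, cycleCount σ j

/-- The total number of cycles of `σ` (fixed points included as 1-cycles). -/
noncomputable def totalCycles {n : ℕ} (σ : Equiv.Perm (Fin n)) : ℕ :=
  cycleCountIn σ (Finset.Icc 1 n)

/-- Probability of an event under a uniformly random permutation of `{1,…,n}`. -/
noncomputable def permP (n : ℕ) (E : Equiv.Perm (Fin n) → Prop) : ℝ :=
  (Nat.card {σ : Equiv.Perm (Fin n) // E σ} : ℝ) / n.factorial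

/-- Expectation of `f` under a uniformly random permutation of `{1,…,n}`. -/
noncomputable def permE (n : ℕ) (f : Equiv.Perm (Fin n) → ℝ) : ℝ :=
  (∑ σ : Equiv.Perm (Fin n), f σ) / n.factorial

/-- `H(I) = ∑_{j ∈ I} 1/j`. -/
noncomputable def Hset (I : Finset ℕ) : ℝ := ∑ j ∈ I, (1 : ℝ) / j

/-- The harmonic sum `H_n = ∑_{i=1}^n 1/i`. -/
noncomputable def harm (n : ℕ) : ℝ := Hset (Finset.Icc 1 n)

noncomputable def zz (s : Multiset ℕ) : ℝ :=
  (s.prod : ℝ) * ∏ k ∈ s.toFinset, ((s.count k).factorial : ℝ)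

lemma zz_cons (a : ℕ) (s : Multiset ℕ) :
    zz (a ::ₘ s) = a * (s.count a + 1) * zz s := by
  classical
  unfold zz
  have key : ∀ t : Multiset ℕ, ∀ S : Finset ℕ, t.toFinset ⊆ S →
      ∏ k ∈ t.toFinset, ((t.count k).factorial : ℝ) = ∏ k ∈ S, ((t.count k).factorial : ℝ) := by
    intro t S h
    apply Finset.prod_subset h
    intro x _ hx
    have : x ∉ t := by simpa using hx
    simp [Multiset.count_eq_zero_of_notMem this]
  rw [key s (a ::ₘ s).toFinset (by intro x; simp; tauto)]
  have ha : a ∈ (a ::ₘ s).toFinset := by simp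
  rw [← Finset.mul_prod_erase _ _ ha, ← Finset.mul_prod_erase _ _ ha]
  have : ∏ k ∈ (a ::ₘ s).toFinset.erase a, (((a ::ₘ s).count k).factorial : ℝ)
      = ∏ k ∈ (a ::ₘ s).toFinset.erase a, ((s.count k).factorial : ℝ) := by
    apply Finset.prod_congr rfl
    intro k hk
    rw [Multiset.count_cons_of_ne (Finset.ne_of_mem_erase hk)]
  rw [this, Multiset.count_cons_self, Nat.factorial_succ, Multiset.prod_cons]
  push_cast
  ring

lemma zz_pos (s : Multiset ℕ) (h : ∀ a ∈ s, 0 < a) : 0 < zz s := by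
  unfold zz
  have : 0 < s.prod := Multiset.prod_pos h
  positivity

lemma zz_replicate (c : ℕ) (s : Multiset ℕ) (h : 1 ∉ s) :
    zz (s + Multiset.replicate c 1) = zz s * c.factorial := by
  induction c with
  | zero => simp
  | succ c ih =>
    rw [Multiset.replicate_succ, Multiset.add_cons, zz_cons, ih, Multiset.count_add,
      Multiset.count_replicate_self, Multiset.count_eq_zero_of_notMem h, Nat.factorial_succ]
    push_cast
    ring

/-- The partition of `n` attached to a permutation. -/
def ppart {n : ℕ} (σ : Equiv.Perm (Fin n)) : n.Partition where
  parts := σ.partition.parts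
  parts_pos := σ.partition.parts_pos
  parts_sum := by simpa using σ.partition.parts_sum

lemma parts_split {n : ℕ} (p : n.Partition) :
    p.parts = p.parts.filter (2 ≤ ·) +
      Multiset.replicate (n - (p.parts.filter (2 ≤ ·)).sum) 1 := by
  have h1 := Multiset.filter_add_not (2 ≤ ·) p.parts
  have h2 : p.parts.filter (fun a => ¬ 2 ≤ a) =
      Multiset.replicate (Multiset.card (p.parts.filter (fun a => ¬ 2 ≤ a))) 1 := by
    rw [Multiset.eq_replicate_card]
    intro b hb
    have := Multiset.mem_filter.1 hb
    have := p.parts_pos this.1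
    omega
  have h3 := p.parts_sum
  rw [← h1, h2] at h3
  simp only [Multiset.sum_add, Multiset.sum_replicate, smul_eq_mul, mul_one] at h3
  have h4 : n - (p.parts.filter (2 ≤ ·)).sum =
      Multiset.card (p.parts.filter (fun a => ¬ 2 ≤ a)) := by omega
  rw [h4, ← h2, h1]

lemma card_ppart {n : ℕ} (p : n.Partition) :
    ((Finset.univ.filter fun σ : Equiv.Perm (Fin n) => ppart σ = p).card : ℝ) * zz p.parts
      = n.factorial := by
  have hsum : (p.parts.filter (2 ≤ ·)).sum ≤ n := by
    have h1 := congrArg Multiset.sum (parts_split p)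
    rw [p.parts_sum, Multiset.sum_add] at h1
    omega
  have h := Equiv.Perm.card_of_cycleType_mul_eq (Fin n) (p.parts.filter (2 ≤ ·))
  rw [if_pos ⟨by simpa using hsum, fun a ha => (Multiset.mem_filter.1 ha).2⟩] at h
  have hset : (Finset.univ.filter fun σ : Equiv.Perm (Fin n) => ppart σ = p)
      = Finset.univ.filter fun σ : Equiv.Perm (Fin n) =>
        σ.cycleType = p.parts.filter (2 ≤ ·) := by
    apply Finset.filter_congr
    intro σ _
    constructor
    · rintro rfl
      exact Equiv.Perm.filter_parts_partition_eq_cycleType.symm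
    · intro hs
      apply Nat.Partition.ext
      rw [parts_split p, parts_split (ppart σ)]
      have : (ppart σ).parts.filter (2 ≤ ·) = σ.cycleType :=
        Equiv.Perm.filter_parts_partition_eq_cycleType
      rw [this, hs]
  rw [hset, parts_split p, zz_replicate _ _ (by simp), ← parts_split p]
  rw [Fintype.card_fin] at h
  rw [← h, zz]
  push_cast
  ring

lemma minPer_eq {n : ℕ} (σ : Equiv.Perm (Fin n)) (x : Fin n) (hx : x ∈ σ.support) :
    Function.minimalPeriod (⇑σ) x = (σ.cycleOf x).support.card := by
  have hc := Equiv.Perm.isCycleOn_support_cycleOf σ x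
  have hx' : x ∈ (σ.cycleOf x).support :=
    (Equiv.Perm.mem_support_cycleOf_iff).2 ⟨Equiv.Perm.SameCycle.refl _ _, hx⟩
  have key : ∀ m, Function.minimalPeriod (⇑σ) x ∣ m ↔ (σ.cycleOf x).support.card ∣ m := by
    intro m
    rw [← Function.isPeriodicPt_iff_minimalPeriod_dvd, ← hc.pow_apply_eq hx',
      Function.IsPeriodicPt, Function.IsFixedPt, Equiv.Perm.iterate_eq_pow]
  exact Nat.dvd_antisymm ((key _).2 dvd_rfl) ((key _).1 dvd_rfl)

lemma cycleCount_eq {n : ℕ} (σ : Equiv.Perm (Fin n)) (j : ℕ) (hj : 1 ≤ j) :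
    cycleCount σ j = (ppart σ).parts.count j := by
  have hparts : (ppart σ).parts = σ.cycleType +
      Multiset.replicate (Fintype.card (Fin n) - σ.support.card) 1 := rfl
  rw [hparts, Multiset.count_add, cycleCount]
  rcases hj.eq_or_lt with rfl | hj
  · have : 1 ∉ σ.cycleType := fun h => by
      have := Equiv.Perm.two_le_of_mem_cycleType h; omega
    rw [Multiset.count_eq_zero_of_notMem this, Multiset.count_replicate_self, Nat.div_one, zero_add,
      ← Finset.card_compl]
    congr 1
    ext x
    simp [Function.minimalPeriod_eq_one_iff_isFixedPt, Function.IsFixedPt]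
  · rw [Multiset.count_replicate, if_neg (by omega), add_zero]
    apply Nat.div_eq_of_eq_mul_left (by omega)
    have hmem : ∀ x, Function.minimalPeriod (⇑σ) x = j → x ∈ σ.support := by
      intro x hx
      by_contra h
      rw [Equiv.Perm.notMem_support] at h
      have := Function.minimalPeriod_eq_one_iff_isFixedPt.2 h
      omega
    rw [Finset.card_eq_sum_card_fiberwise (f := fun x => σ.cycleOf x)
      (t := σ.cycleFactorsFinset.filter fun c => c.support.card = j)]
    · rw [Equiv.Perm.cycleType_def, Multiset.count_map]
      rw [Finset.sum_congr rfl (g := fun _ => j)]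
      · rw [Finset.sum_const, smul_eq_mul]
        congr 1
        rw [Finset.card_def, Finset.filter_val]
        congr 1
        apply Multiset.filter_congr
        intro c _
        simp [eq_comm]
      · intro c hc
        rw [Finset.mem_filter] at hc
        rw [← hc.2]
        congr 1
        ext x
        simp only [Finset.mem_filter, Finset.mem_univ, true_and]
        constructor
        · rintro ⟨h1, rfl⟩
          have := hmem x (h1.trans hc.2)
          exact (Equiv.Perm.mem_support_cycleOf_iff).2 ⟨Equiv.Perm.SameCycle.refl _ _, this⟩
        · intro hx
          have h2 := Equiv.Perm.cycle_is_cycleOf hx hc.1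
          have h3 : x ∈ σ.support := Equiv.Perm.mem_cycleFactorsFinset_support_le hc.1 hx
          exact ⟨by rw [minPer_eq σ x h3, ← h2], h2.symm⟩
    · intro x hx
      have hx : Function.minimalPeriod (⇑σ) x = j := by simpa using hx
      have := hmem x hx
      simp only [Finset.coe_filter, Set.mem_ofPred_eq]
      exact ⟨Equiv.Perm.cycleOf_mem_cycleFactorsFinset_iff.2 this, by rw [← minPer_eq σ x this, hx]⟩

/-- Normalized weighted count of permutations of `n` points. -/
noncomputable def FF (w : ℕ → ℝ) (n : ℕ) : ℝ :=
  ∑ p : n.Partition, (p.parts.map w).prod / zz p.parts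

lemma FF_zero (w : ℕ → ℝ) : FF w 0 = 1 := by
  unfold FF
  rw [Fintype.sum_unique]
  simp [zz]

lemma FF_nonneg (w : ℕ → ℝ) (hw : ∀ k, 0 ≤ w k) (n : ℕ) : 0 ≤ FF w n := by
  unfold FF
  apply Finset.sum_nonneg
  intro p _
  apply div_nonneg
  · apply Multiset.prod_nonneg
    intro a ha
    obtain ⟨k, _, rfl⟩ := Multiset.mem_map.1 ha
    exact hw k
  · exact (zz_pos _ fun a ha => p.parts_pos ha).le

lemma FF_rec (w : ℕ → ℝ) (n : ℕ) :
    (n : ℝ) * FF w n = ∑ k ∈ Finset.Icc 1 n, w k * FF w (n - k) := by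
  have hn : ∀ p : n.Partition, (n : ℝ) = ∑ k ∈ Finset.Icc 1 n, (p.parts.count k : ℝ) * k := by
    intro p
    have h1 : n = ∑ k ∈ Finset.Icc 1 n, p.parts.count k * k := by
      conv_lhs => rw [← p.parts_sum, Finset.sum_multiset_count]
      simp only [smul_eq_mul]
      apply Finset.sum_subset
      · intro k hk
        have hk : k ∈ p.parts := by simpa using hk
        exact Finset.mem_Icc.2 ⟨p.parts_pos hk, p.le_of_mem_parts hk⟩
      · intro k _ hk
        have hk : k ∉ p.parts := by simpa using hk
        simp [Multiset.count_eq_zero_of_notMem hk]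
    exact_mod_cast h1
  have step : (n : ℝ) * FF w n = ∑ k ∈ Finset.Icc 1 n, ∑ p : n.Partition,
      (p.parts.count k : ℝ) * k * ((p.parts.map w).prod / zz p.parts) := by
    rw [Finset.sum_comm, FF, Finset.mul_sum]
    apply Finset.sum_congr rfl
    intro p _
    rw [← Finset.sum_mul, ← hn p]
  rw [step]
  apply Finset.sum_congr rfl
  intro k hk
  obtain ⟨hk1, hk2⟩ := Finset.mem_Icc.1 hk
  rw [FF, Finset.mul_sum,
    ← Equiv.sum_comp (Nat.Partition.partitionWithPartEquiv hk1 hk2)]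
  rw [← Finset.sum_filter_of_ne (p := fun p : n.Partition => k ∈ p.parts)]
  · rw [Finset.sum_subtype (p := fun p : n.Partition => k ∈ p.parts) _ (by simp)]
    apply Finset.sum_congr rfl
    rintro ⟨p, hp⟩ _
    rw [Nat.Partition.partitionWithPartEquiv_apply_parts]
    obtain ⟨s, hs⟩ := Multiset.exists_cons_of_mem hp
    simp only [hs, Multiset.erase_cons_head]
    have hz : 0 < zz s := zz_pos _ fun a ha => p.parts_pos (by rw [hs]; simp [ha])
    rw [zz_cons, Multiset.count_cons_self, Multiset.map_cons, Multiset.prod_cons]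
    have hk0 : (0 : ℝ) < k := by exact_mod_cast hk1
    push_cast
    field_simp
  · intro p _ hne
    by_contra h
    exact hne (by simp [Multiset.count_eq_zero_of_notMem h])

lemma shift_sum (g : ℕ → ℝ) (hg : ∀ l, 0 ≤ g l) (k n : ℕ) :
    ∑ m ∈ Finset.Icc k n, g (m - k) ≤ ∑ l ∈ Finset.range (n + 1), g l := by
  rw [← Finset.sum_image (f := g) (g := fun m => m - k) (s := Finset.Icc k n)]
  · apply Finset.sum_le_sum_of_subset_of_nonneg
    · intro x hx
      simp only [Finset.mem_image, Finset.mem_Icc, Finset.mem_range] at hx ⊢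
      omega
    · intros; exact hg _
  · intro a ha b hb h
    simp only [Finset.coe_Icc, Set.mem_Icc] at ha hb
    simp only at h
    omega

lemma deriv_bound (w : ℕ → ℝ) (hw : ∀ k, 0 ≤ w k) (n : ℕ) (r : ℝ) (hr : 0 ≤ r) :
    ∑ m ∈ Finset.range (n + 1), FF w m * (m * r ^ (m - 1))
      ≤ (∑ k ∈ Finset.Icc 1 n, w k * r ^ (k - 1)) *
        ∑ m ∈ Finset.range (n + 1), FF w m * r ^ m := by
  have h1 : ∀ m ∈ Finset.range (n + 1), FF w m * (m * r ^ (m - 1)) =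
      ∑ k ∈ Finset.Icc 1 m, w k * r ^ (k - 1) * (FF w (m - k) * r ^ (m - k)) := by
    intro m _
    have := FF_rec w m
    calc FF w m * (m * r ^ (m - 1)) = (m * FF w m) * r ^ (m - 1) := by ring
      _ = _ := by
        rw [this, Finset.sum_mul]
        apply Finset.sum_congr rfl
        intro k hk
        obtain ⟨hk1, hk2⟩ := Finset.mem_Icc.1 hk
        have : m - 1 = (k - 1) + (m - k) := by omega
        rw [this, pow_add]
        ring
  rw [Finset.sum_congr rfl h1, Finset.sum_comm' (t' := Finset.Icc 1 n)
    (s' := fun k => Finset.Icc k n), Finset.sum_mul]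
  · apply Finset.sum_le_sum
    intro k _
    rw [← Finset.mul_sum]
    apply mul_le_mul_of_nonneg_left _ (mul_nonneg (hw k) (pow_nonneg hr _))
    exact shift_sum (fun l => FF w l * r ^ l)
      (fun l => mul_nonneg (FF_nonneg w hw l) (pow_nonneg hr _)) k n
  · intro x y
    simp only [Finset.mem_range, Finset.mem_Icc]
    omega

lemma partial_sum_bound (w : ℕ → ℝ) (hw : ∀ k, 0 ≤ w k) (n : ℕ) :
    ∑ m ∈ Finset.range (n + 1), FF w m ≤ Real.exp (∑ k ∈ Finset.Icc 1 n, w k / k) := by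
  set f : ℝ → ℝ := fun r => ∑ m ∈ Finset.range (n + 1), FF w m * r ^ m with hf
  set e : ℝ → ℝ := fun r => ∑ k ∈ Finset.Icc 1 n, w k / k * r ^ k with he
  have df : ∀ r, HasDerivAt f (∑ m ∈ Finset.range (n + 1), FF w m * (m * r ^ (m - 1))) r := by
    intro r
    apply HasDerivAt.fun_sum
    intro m _
    exact (hasDerivAt_pow m r).const_mul _
  have de : ∀ r, HasDerivAt e (∑ k ∈ Finset.Icc 1 n, w k * r ^ (k - 1)) r := by
    intro r
    have : ∑ k ∈ Finset.Icc 1 n, w k * r ^ (k - 1) =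
        ∑ k ∈ Finset.Icc 1 n, w k / k * (k * r ^ (k - 1)) := by
      apply Finset.sum_congr rfl
      intro k hk
      have : (0 : ℝ) < k := by exact_mod_cast (Finset.mem_Icc.1 hk).1
      field_simp
    rw [this]
    apply HasDerivAt.fun_sum
    intro m _
    exact (hasDerivAt_pow m r).const_mul _
  have dg : ∀ r, HasDerivAt (fun r => f r * Real.exp (-e r)) _ r :=
    fun r => (df r).mul ((de r).neg.exp)
  have hanti : AntitoneOn (fun r => f r * Real.exp (-e r)) (Set.Icc 0 1) := by
    apply antitoneOn_of_deriv_nonpos (convex_Icc 0 1)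
    · exact fun r _ => (dg r).continuousAt.continuousWithinAt
    · exact fun r _ => (dg r).differentiableAt.differentiableWithinAt
    · intro r hr
      rw [interior_Icc] at hr
      rw [(dg r).deriv]
      have hb := deriv_bound w hw n r hr.1.le
      have hx := Real.exp_pos (-e r)
      have : f r = ∑ m ∈ Finset.range (n + 1), FF w m * r ^ m := rfl
      rw [← this] at hb
      rw [Pi.neg_apply]
      have := mul_le_mul_of_nonneg_right hb hx.le
      linarith
  have h01 := hanti (Set.left_mem_Icc.2 zero_le_one) (Set.right_mem_Icc.2 zero_le_one) zero_le_one
  have f0 : f 0 = 1 := by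
    simp only [hf]
    rw [Finset.sum_eq_single 0]
    · simp [FF_zero]
    · intro b _ hb; simp [hb]
    · simp
  have e0 : e 0 = 0 := by
    simp only [he]
    apply Finset.sum_eq_zero
    intro k hk
    have : k ≠ 0 := by have := (Finset.mem_Icc.1 hk).1; omega
    simp [this]
  have f1 : f 1 = ∑ m ∈ Finset.range (n + 1), FF w m := by simp [hf]
  have e1 : e 1 = ∑ k ∈ Finset.Icc 1 n, w k / k := by simp [he]
  simp only [f0, e0, f1, e1, neg_zero, Real.exp_zero, mul_one] at h01
  rw [Real.exp_neg, ← div_eq_mul_inv, div_le_one (Real.exp_pos _)] at h01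
  exact h01

lemma FF_bound (w : ℕ → ℝ) (hw : ∀ k, 0 ≤ w k) (hw1 : ∀ k, w k ≤ 1) (n : ℕ) (hn : 1 ≤ n) :
    FF w n ≤ Real.exp (1 - ∑ k ∈ Finset.Icc 1 n, (1 - w k) / k) := by
  have hn0 : (0 : ℝ) < n := by exact_mod_cast hn
  have h1 : (n : ℝ) * FF w n ≤ Real.exp (∑ k ∈ Finset.Icc 1 n, w k / k) := by
    refine le_trans ?_ (partial_sum_bound w hw n)
    rw [FF_rec]
    calc ∑ k ∈ Finset.Icc 1 n, w k * FF w (n - k)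
        ≤ ∑ k ∈ Finset.Icc 1 n, FF w (n - k) := by
          apply Finset.sum_le_sum
          intro k _
          exact mul_le_of_le_one_left (FF_nonneg w hw _) (hw1 k)
      _ = ∑ m ∈ Finset.range n, FF w m := by
          apply Finset.sum_bij' (fun k _ => n - k) (fun m _ => n - m)
          all_goals intro a ha
          all_goals simp only [Finset.mem_Icc, Finset.mem_range] at ha ⊢
          all_goals omega
      _ ≤ _ := by
          rw [Finset.sum_range_succ]
          linarith [FF_nonneg w hw n]
  have h2 : ∑ k ∈ Finset.Icc 1 n, (1 : ℝ) / k ≤ 1 + Real.log n := by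
    have := harmonic_le_one_add_log n
    rw [harmonic_eq_sum_Icc] at this
    push_cast at this
    simpa [one_div] using this
  have h3 : ∑ k ∈ Finset.Icc 1 n, w k / k =
      ∑ k ∈ Finset.Icc 1 n, (1 : ℝ) / k - ∑ k ∈ Finset.Icc 1 n, (1 - w k) / k := by
    rw [← Finset.sum_sub_distrib]
    apply Finset.sum_congr rfl
    intro k _
    ring
  have h4 : Real.exp (∑ k ∈ Finset.Icc 1 n, w k / k) ≤
      n * Real.exp (1 - ∑ k ∈ Finset.Icc 1 n, (1 - w k) / k) := by
    nth_rewrite 1 [← Real.exp_log hn0]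
    rw [← Real.exp_add]
    apply Real.exp_le_exp.2
    linarith
  exact le_of_mul_le_mul_left (h1.trans h4) hn0

lemma prod_weight (I : Finset ℕ) (lam : ℝ) (s : Multiset ℕ) :
    (s.map fun k => if k ∈ I then lam else 1).prod = lam ^ (∑ j ∈ I, s.count j) := by
  induction s using Multiset.induction_on with
  | empty => simp
  | cons a s ih =>
    rw [Multiset.map_cons, Multiset.prod_cons, ih]
    simp only [Multiset.count_cons, Finset.sum_add_distrib, pow_add]
    rw [Finset.sum_ite_eq']
    split_ifs <;> simp [mul_comm]

lemma sum_perm (n : ℕ) (I : Finset ℕ) (hsub : I ⊆ Finset.Icc 1 n) (lam : ℝ) :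
    ∑ σ : Equiv.Perm (Fin n), lam ^ cycleCountIn σ I =
      n.factorial * FF (fun k => if k ∈ I then lam else 1) n := by
  rw [← Finset.sum_fiberwise (s := Finset.univ) (g := fun σ : Equiv.Perm (Fin n) => ppart σ),
    FF, Finset.mul_sum]
  apply Finset.sum_congr rfl
  intro p _
  have hz : 0 < zz p.parts := zz_pos _ fun a ha => p.parts_pos ha
  rw [prod_weight, Finset.sum_congr rfl (g := fun _ => lam ^ (∑ j ∈ I, p.parts.count j))]
  · rw [Finset.sum_const, nsmul_eq_mul, ← card_ppart p]
    field_simp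
  · intro σ hσ
    have hσ := (Finset.mem_filter.1 hσ).2
    rw [cycleCountIn, Finset.sum_congr rfl]
    intro j hj
    rw [cycleCount_eq σ j (Finset.mem_Icc.1 (hsub hj)).1, hσ]

/-- **Lower tail bound.** For nonempty `I ⊆ [n]` and `0 ≤ λ ≤ 1`,
`P(C_I(σ) ≤ λ H(I)) ≤ 2 e^{1 - Q(λ) H(I)}` where `Q(λ) = λ log λ - λ + 1`
(with `Q(0) = 1`; note `Real.log 0 = 0` in Lean so the formula below gives
`Q 0 = 1`). -/
theorem lower_tail_bound (n : ℕ) (I : Finset ℕ) (hne : I.Nonempty)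
    (hsub : I ⊆ Finset.Icc 1 n) (lam : ℝ) (h0 : 0 ≤ lam) (h1 : lam ≤ 1) :
    permP n (fun σ => (cycleCountIn σ I : ℝ) ≤ lam * Hset I)
      ≤ 2 * Real.exp (1 - (lam * Real.log lam - lam + 1) * Hset I) := by
  classical
  have hn : 1 ≤ n := by
    obtain ⟨j, hj⟩ := hne
    have := Finset.mem_Icc.1 (hsub hj)
    omega
  have hfac : (0 : ℝ) < n.factorial := by exact_mod_cast n.factorial_pos
  set w : ℕ → ℝ := fun k => if k ∈ I then lam else 1 with hw
  have hw0 : ∀ k, 0 ≤ w k := by intro k; simp only [hw]; split_ifs <;> linarith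
  have hw1 : ∀ k, w k ≤ 1 := by intro k; simp only [hw]; split_ifs <;> linarith
  have hF := FF_bound w hw0 hw1 n hn
  have hS : ∑ k ∈ Finset.Icc 1 n, (1 - w k) / k = (1 - lam) * Hset I := by
    rw [Hset, Finset.mul_sum]
    symm
    rw [← Finset.sum_subset hsub]
    · apply Finset.sum_congr rfl
      intro k hk
      simp only [hw, if_pos hk]
      ring
    · intro k _ hk
      simp [hw, hk]
  rw [hS] at hF
  set K := Real.exp (lam * Real.log lam * Hset I) with hK
  have hKpos : 0 < K := Real.exp_pos _
  have hpt : ∀ σ : Equiv.Perm (Fin n), (cycleCountIn σ I : ℝ) ≤ lam * Hset I →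
      K ≤ lam ^ cycleCountIn σ I := by
    intro σ hσ
    rcases h0.eq_or_lt with h | h
    · subst h
      have : cycleCountIn σ I = 0 := by
        have : (cycleCountIn σ I : ℝ) ≤ 0 := by simpa using hσ
        exact_mod_cast le_antisymm this (Nat.cast_nonneg _)
      simp [hK, this]
    · have hlog : Real.log lam ≤ 0 := Real.log_nonpos h0 h1
      rw [← Real.exp_log (pow_pos h _), Real.log_pow, hK]
      apply Real.exp_le_exp.2
      nlinarith
  have hcount : (Nat.card {σ : Equiv.Perm (Fin n) // (cycleCountIn σ I : ℝ) ≤ lam * Hset I} : ℝ) * K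
      ≤ n.factorial * FF w n := by
    rw [← sum_perm n I hsub lam, Nat.card_eq_fintype_card, Fintype.card_subtype, ← nsmul_eq_mul,
      ← Finset.sum_const]
    refine le_trans (Finset.sum_le_sum fun σ hσ => hpt σ (Finset.mem_filter.1 hσ).2) ?_
    apply Finset.sum_le_sum_of_subset_of_nonneg (Finset.filter_subset _ _)
    intros
    exact pow_nonneg h0 _
  have hP : permP n (fun σ => (cycleCountIn σ I : ℝ) ≤ lam * Hset I) ≤
      Real.exp (1 - (lam * Real.log lam - lam + 1) * Hset I) := by
    have hsplit : Real.exp (1 - (lam * Real.log lam - lam + 1) * Hset I) * K =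
        Real.exp (1 - (1 - lam) * Hset I) := by
      rw [hK, ← Real.exp_add]
      congr 1
      ring
    rw [permP, div_le_iff₀ hfac]
    refine le_of_mul_le_mul_right ?_ hKpos
    calc _ ≤ n.factorial * FF w n := hcount
      _ ≤ n.factorial * Real.exp (1 - (1 - lam) * Hset I) :=
        mul_le_mul_of_nonneg_left hF hfac.le
      _ = _ := by rw [← hsplit]; ring
  have := Real.exp_pos (1 - (lam * Real.log lam - lam + 1) * Hset I)
  linarith
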